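/- Exactly 24 of the 450 3-concordant ranking systems on a 4-element set contain a directed 4-cycle: i.e., there exist distinct elements a₀, a₁, a₂, a₃ such that the 4-loop of 0-simplices {a₀,a₁}, {a₁,a₂}, {a₂,a₃}, {a₃,a₀} is a directed 4-cycle in the induced orientation of the line graph. Equivalently, exactly 24 of the 450 are not 4-concordant. -/

import Mathlib

/-- `lt` encodes a ranking system on the 4-element set `Fin 4`:
`lt x y z = true` means `y ≺_x z`; for each `x`, `lt x` is a strict linear
order on `Fin 4 \ {x}` (and holds only for arguments distinct from `x` and
from each other). -/
def IsRankSys (lt : Fin 4 → Fin 4 → Fin 4 → Bool) : Prop :=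
  (∀ x y z : Fin 4, lt x y z = true → y ≠ x ∧ z ≠ x ∧ y ≠ z) ∧
  (∀ x y z w : Fin 4, lt x y z = true → lt x z w = true → lt x y w = true) ∧
  (∀ x y z : Fin 4, y ≠ x → z ≠ x → y ≠ z → (lt x y z = true ∨ lt x z y = true)) ∧
  (∀ x y z : Fin 4, lt x y z = true → lt x z y = false)

/-- `lt` is 3-concordant: no three distinct elements `x, y, z` satisfy
`x ≺_y z`, `y ≺_z x`, and `z ≺_x y`. -/
def ThreeConc (lt : Fin 4 → Fin 4 → Fin 4 → Bool) : Prop :=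
  ∀ x y z : Fin 4, x ≠ y → y ≠ z → x ≠ z →
    ¬(lt y x z = true ∧ lt z y x = true ∧ lt x z y = true)

instance : DecidablePred IsRankSys := fun lt => by
  unfold IsRankSys; infer_instance

instance : DecidablePred ThreeConc := fun lt => by
  unfold ThreeConc; infer_instance

/-- The comparison on `Fin 4 \ {x}` whose values on the three increasing pairs are the entries
of `c`. -/
def rowOfBits (x : Fin 4) (c : Bool × Bool × Bool) : Fin 4 → Fin 4 → Bool :=
  let p := c.1
  let q := c.2.1
  let r := c.2.2
  match x with
  | 0 => ![![false, false, false, false], ![false, false, p, q],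
      ![false, !p, false, r], ![false, !q, !r, false]]
  | 1 => ![![false, false, p, q], ![false, false, false, false],
      ![!p, false, false, r], ![!q, false, !r, false]]
  | 2 => ![![false, p, false, q], ![!p, false, false, r],
      ![false, false, false, false], ![!q, !r, false, false]]
  | 3 => ![![false, p, q, false], ![!p, false, r, false],
      ![!q, !r, false, false], ![false, false, false, false]]

/-- The family of comparisons with prescribed rows. -/
def sysOfBits (b : (Bool × Bool × Bool) × (Bool × Bool × Bool) ×
    (Bool × Bool × Bool) × (Bool × Bool × Bool)) : Fin 4 → Fin 4 → Fin 4 → Bool :=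
  ![rowOfBits 0 b.1, rowOfBits 1 b.2.1, rowOfBits 2 b.2.2.1, rowOfBits 3 b.2.2.2]

/-- The values of `lt` on the increasing pairs of each row. -/
def bitsOfSys (lt : Fin 4 → Fin 4 → Fin 4 → Bool) : (Bool × Bool × Bool) × (Bool × Bool × Bool) ×
    (Bool × Bool × Bool) × (Bool × Bool × Bool) :=
  ((lt 0 1 2, lt 0 1 3, lt 0 2 3), (lt 1 0 2, lt 1 0 3, lt 1 2 3),
    (lt 2 0 1, lt 2 0 3, lt 2 1 3), (lt 3 0 1, lt 3 0 2, lt 3 1 2))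

theorem bitsOfSys_sysOfBits (b) : bitsOfSys (sysOfBits b) = b := rfl

theorem IsRankSys.sysOfBits_bitsOfSys {lt : Fin 4 → Fin 4 → Fin 4 → Bool} (h : IsRankSys lt) :
    sysOfBits (bitsOfSys lt) = lt := by
  obtain ⟨hne, -, htot, hasymm⟩ := h
  have hfalse (x y z : Fin 4) (hxyz : y = x ∨ z = x ∨ y = z) : lt x y z = false := by
    by_contra hc
    have := hne x y z (by simpa using hc)
    tauto
  have hnot (x y z : Fin 4) (hy : y ≠ x) (hz : z ≠ x) (hyz : y ≠ z) :
      lt x z y = !lt x y z := by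
    have h1 := htot x y z hy hz hyz
    have h2 := hasymm x y z
    cases hb : lt x y z <;> simp_all
  funext x y z
  fin_cases x <;> fin_cases y <;> fin_cases z <;>
    first
    | rfl
    | exact (hfalse _ _ _ (by decide)).symm
    | exact (hnot _ _ _ (by decide) (by decide) (by decide)).symm

/-- The comparison encoded by a triple of bits has no cyclic triple. -/
def acyclicBits (c : Bool × Bool × Bool) : Bool :=
  !(c.1 && c.2.2 && !c.2.1) && !(!c.1 && !c.2.2 && c.2.1)

/-- Absence of directed 3-cycles, in terms of bits. -/
def threeConcBits : (Bool × Bool × Bool) × (Bool × Bool × Bool) ×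
    (Bool × Bool × Bool) × (Bool × Bool × Bool) → Bool
  | ((p0, q0, r0), (p1, q1, r1), (p2, q2, r2), (p3, q3, r3)) =>
    !(p1 && !p2 && !p0) &&
    !(p2 && !p1 && p0) &&
    !(q1 && !p3 && !q0) &&
    !(p3 && !q1 && q0) &&
    !(q2 && !q3 && !r0) &&
    !(q3 && !q2 && r0) &&
    !(r2 && !r3 && !r1) &&
    !(r3 && !r2 && r1)

/-- Existence of a directed 4-cycle, in terms of bits. -/
def fourCycleBits : (Bool × Bool × Bool) × (Bool × Bool × Bool) ×
    (Bool × Bool × Bool) × (Bool × Bool × Bool) → Bool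
  | ((p0, q0, r0), (p1, q1, r1), (p2, q2, r2), (p3, q3, r3)) =>
    (!q0 && p1 && r2 && !q3) ||
    (!p0 && q1 && r3 && !q2) ||
    (!r0 && p2 && r1 && !p3) ||
    (p0 && q2 && !r3 && !q1) ||
    (r0 && p3 && !r1 && !p2) ||
    (q0 && q3 && !r2 && !p1)

theorem rowOfBits_trans_iff (x : Fin 4) (c : Bool × Bool × Bool) :
    (∀ y z w, rowOfBits x c y z = true → rowOfBits x c z w = true → rowOfBits x c y w = true) ↔
      acyclicBits c = true := by
  revert x c
  decide +kernel

theorem rowOfBits_basic (x : Fin 4) (c : Bool × Bool × Bool) (y z : Fin 4) :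
    (rowOfBits x c y z = true → y ≠ x ∧ z ≠ x ∧ y ≠ z) ∧
    (y ≠ x → z ≠ x → y ≠ z → (rowOfBits x c y z = true ∨ rowOfBits x c z y = true)) ∧
    (rowOfBits x c y z = true → rowOfBits x c z y = false) := by
  revert x c y z
  decide +kernel

theorem isRankSys_sysOfBits_iff (c0 c1 c2 c3 : Bool × Bool × Bool) :
    IsRankSys (sysOfBits (c0, c1, c2, c3)) ↔ acyclicBits c0 = true ∧ acyclicBits c1 = true ∧
      acyclicBits c2 = true ∧ acyclicBits c3 = true := by
  have hrow (x : Fin 4) : sysOfBits (c0, c1, c2, c3) x = rowOfBits x (![c0, c1, c2, c3] x) := by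
    fin_cases x <;> rfl
  simp only [IsRankSys, hrow]
  have h1 := fun x => rowOfBits_basic x (![c0, c1, c2, c3] x)
  have h2 : (∀ x y z w : Fin 4, rowOfBits x (![c0, c1, c2, c3] x) y z = true →
      rowOfBits x (![c0, c1, c2, c3] x) z w = true →
      rowOfBits x (![c0, c1, c2, c3] x) y w = true) ↔
      ∀ x, acyclicBits (![c0, c1, c2, c3] x) = true :=
    forall_congr' fun x => rowOfBits_trans_iff x _
  rw [h2, and_iff_right fun x y z => (h1 x y z).1, and_iff_left
    ⟨fun x y z => (h1 x y z).2.1, fun x y z => (h1 x y z).2.2⟩]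
  simp [Fin.forall_fin_succ]

theorem threeConc_sysOfBits_iff (b) :
    ThreeConc (sysOfBits b) ↔ threeConcBits b = true := by
  obtain ⟨⟨p0, q0, r0⟩, ⟨p1, q1, r1⟩, ⟨p2, q2, r2⟩, ⟨p3, q3, r3⟩⟩ := b
  simp [ThreeConc, Fin.forall_fin_succ, sysOfBits, rowOfBits, threeConcBits]
  constructor
  · intro h
    and_intros <;> grind
  · intro h
    and_intros <;> grind

theorem exists_directed_four_cycle_sysOfBits_iff (b) :
    (∃ a0 a1 a2 a3 : Fin 4, a0 ≠ a1 ∧ a0 ≠ a2 ∧ a0 ≠ a3 ∧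
      a1 ≠ a2 ∧ a1 ≠ a3 ∧ a2 ≠ a3 ∧
      ((sysOfBits b a1 a0 a2 = true ∧ sysOfBits b a2 a1 a3 = true ∧
          sysOfBits b a3 a2 a0 = true ∧ sysOfBits b a0 a3 a1 = true) ∨
        (sysOfBits b a1 a2 a0 = true ∧ sysOfBits b a2 a3 a1 = true ∧
          sysOfBits b a3 a0 a2 = true ∧ sysOfBits b a0 a1 a3 = true))) ↔
      fourCycleBits b = true := by
  obtain ⟨⟨p0, q0, r0⟩, ⟨p1, q1, r1⟩, ⟨p2, q2, r2⟩, ⟨p3, q3, r3⟩⟩ := b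
  simp [Fin.exists_fin_succ, sysOfBits, rowOfBits, fourCycleBits]
  constructor <;> intro h <;> casesm* _ ∨ _ <;> simp_all

theorem card_filter_bits :
    (Finset.univ.filter fun b : (Bool × Bool × Bool) × (Bool × Bool × Bool) ×
      (Bool × Bool × Bool) × (Bool × Bool × Bool) =>
        (acyclicBits b.1 && (acyclicBits b.2.1 && (acyclicBits b.2.2.1 &&
          (acyclicBits b.2.2.2 && (threeConcBits b && fourCycleBits b))))) = true).card = 24 := by
  decide +kernel

theorem isRankSys_and_threeConc_and_fourCycle_sysOfBits_iff (b) :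
    (IsRankSys (sysOfBits b) ∧ ThreeConc (sysOfBits b) ∧
      ∃ a0 a1 a2 a3 : Fin 4, a0 ≠ a1 ∧ a0 ≠ a2 ∧ a0 ≠ a3 ∧
        a1 ≠ a2 ∧ a1 ≠ a3 ∧ a2 ≠ a3 ∧
        ((sysOfBits b a1 a0 a2 = true ∧ sysOfBits b a2 a1 a3 = true ∧
            sysOfBits b a3 a2 a0 = true ∧ sysOfBits b a0 a3 a1 = true) ∨
          (sysOfBits b a1 a2 a0 = true ∧ sysOfBits b a2 a3 a1 = true ∧
            sysOfBits b a3 a0 a2 = true ∧ sysOfBits b a0 a1 a3 = true))) ↔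
      (acyclicBits b.1 && (acyclicBits b.2.1 && (acyclicBits b.2.2.1 &&
        (acyclicBits b.2.2.2 && (threeConcBits b && fourCycleBits b))))) = true := by
  rw [exists_directed_four_cycle_sysOfBits_iff, threeConc_sysOfBits_iff, isRankSys_sysOfBits_iff]
  simp only [Bool.and_eq_true, and_assoc]

/-- Exactly 24 of the 450 3-concordant ranking systems on a 4-element set
contain a directed 4-cycle (i.e. are not 4-concordant): there are distinct
`a₀, a₁, a₂, a₃` with the 4-loop `{a₀,a₁}, {a₁,a₂}, {a₂,a₃}, {a₃,a₀}`
directed consistently around, forward or backward. -/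
theorem stmt18 :
    (Finset.univ.filter
      (fun lt : Fin 4 → Fin 4 → Fin 4 → Bool =>
        IsRankSys lt ∧ ThreeConc lt ∧
        ∃ a0 a1 a2 a3 : Fin 4, a0 ≠ a1 ∧ a0 ≠ a2 ∧ a0 ≠ a3 ∧
          a1 ≠ a2 ∧ a1 ≠ a3 ∧ a2 ≠ a3 ∧
          ((lt a1 a0 a2 = true ∧ lt a2 a1 a3 = true ∧ lt a3 a2 a0 = true ∧
              lt a0 a3 a1 = true) ∨
           (lt a1 a2 a0 = true ∧ lt a2 a3 a1 = true ∧ lt a3 a0 a2 = true ∧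
              lt a0 a1 a3 = true)))).card = 24 := by
  rw [← card_filter_bits]
  refine Finset.card_nbij' bitsOfSys sysOfBits ?_ ?_ ?_ fun _ _ => bitsOfSys_sysOfBits _ <;>
    simp only [Set.MapsTo, Set.LeftInvOn, Finset.coe_filter, Finset.mem_univ, true_and,
      Set.mem_ofPred_eq]
  · intro lt h
    rw [← isRankSys_and_threeConc_and_fourCycle_sysOfBits_iff, h.1.sysOfBits_bitsOfSys]
    exact h
  · exact fun b => (isRankSys_and_threeConc_and_fourCycle_sysOfBits_iff b).2
  · exact fun lt h => h.1.sysOfBits_bitsOfSys
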